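/- arXiv:0708.2960 — 2 statements merged into one kernel-verified Lean document; each statement's English description precedes it below -/
import Mathlib

section
/- Let (f_0,…,f_5) be a rational solution of the A_5^(1) Painlevé system A_5(α_0,…,α_5). Then each f_i is an odd function: for every t ∈ ℂ at which f_i is defined, f_i is also defined at −t and f_i(−t) = −f_i(t). -/
open Filter Topology Polynomial

noncomputable section

/-- Evaluation of a complex rational function at a point (junk value where the
reduced denominator vanishes). -/
def evalR (f : RatFunc ℂ) (t : ℂ) : ℂ := RatFunc.eval (RingHom.id ℂ) t f

/-- `f` is defined at `t`: the reduced denominator does not vanish at `t`. -/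
def DefinedAt (f : RatFunc ℂ) (t : ℂ) : Prop := Polynomial.eval t (RatFunc.denom f) ≠ 0

/-- `(f 0, …, f 5)` is a rational solution of the `A₅⁽¹⁾` Painlevé system `A₅(α)`:
the two constraints hold identically as rational functions, and the six ODEs hold at
every point where all six components are defined.  (Indices are taken in `Fin 6`,
i.e. modulo `6`.) -/
def IsA5Solution (α : Fin 6 → ℂ) (f : Fin 6 → RatFunc ℂ) : Prop :=
  f 0 + f 2 + f 4 = RatFunc.X ∧
  f 1 + f 3 + f 5 = RatFunc.X ∧
  ∀ t : ℂ, (∀ j : Fin 6, DefinedAt (f j) t) → ∀ i : Fin 6,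
    t / 2 * deriv (evalR (f i)) t =
      evalR (f i) t *
        (evalR (f (i + 1)) t * evalR (f (i + 2)) t
          + evalR (f (i + 1)) t * evalR (f (i + 4)) t
          + evalR (f (i + 3)) t * evalR (f (i + 4)) t
          - evalR (f (i + 2)) t * evalR (f (i + 3)) t
          - evalR (f (i + 2)) t * evalR (f (i + 5)) t
          - evalR (f (i + 4)) t * evalR (f (i + 5)) t)
      + (1 / 2 - α (i + 2) - α (i + 4)) * evalR (f i) t
      + α i * (evalR (f (i + 2)) t + evalR (f (i + 4)) t)

/-- `f` has a pole at `t = ∞`: `‖f t‖ → ∞` as `‖t‖ → ∞`. -/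
def PoleAtInfty (f : RatFunc ℂ) : Prop :=
  Tendsto (fun t => ‖evalR f t‖) (Bornology.cobounded ℂ) atTop

/-- `f` is holomorphic at `t = ∞`: `f` is bounded as `‖t‖ → ∞`. -/
def HoloAtInfty (f : RatFunc ℂ) : Prop :=
  IsBoundedUnder (· ≤ ·) (Bornology.cobounded ℂ) fun t => ‖evalR f t‖

/-- `f` has a pole at `c ∈ ℂ`: `‖f t‖ → ∞` as `t → c`. -/
def PoleAt (f : RatFunc ℂ) (c : ℂ) : Prop :=
  Tendsto (fun t => ‖evalR f t‖) (𝓝[≠] c) atTop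

/-- `f` is regular at `c ∈ ℂ`: it extends continuously to `c`. -/
def RegularAt (f : RatFunc ℂ) (c : ℂ) : Prop :=
  ∃ L : ℂ, Tendsto (fun t => evalR f t) (𝓝[≠] c) (𝓝 L)

/-- `z` is an integer. -/
def IsInt (z : ℂ) : Prop := ∃ n : ℤ, z = (n : ℂ)

/-- `z` is an even integer. -/
def IsEvenInt (z : ℂ) : Prop := ∃ n : ℤ, z = 2 * (n : ℂ)

/-- A tuple of rational functions has pole configuration of Type A at `t = ∞`. -/
def TypeA (f : Fin 6 → RatFunc ℂ) : Prop :=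
  ∃ i : Fin 6,
    (PoleAtInfty (f i) ∧ PoleAtInfty (f (i + 1)) ∧ HoloAtInfty (f (i + 2)) ∧
      HoloAtInfty (f (i + 3)) ∧ HoloAtInfty (f (i + 4)) ∧ HoloAtInfty (f (i + 5))) ∨
    (PoleAtInfty (f i) ∧ PoleAtInfty (f (i + 3)) ∧ HoloAtInfty (f (i + 1)) ∧
      HoloAtInfty (f (i + 2)) ∧ HoloAtInfty (f (i + 4)) ∧ HoloAtInfty (f (i + 5))) ∨
    (PoleAtInfty (f i) ∧ PoleAtInfty (f (i + 1)) ∧ PoleAtInfty (f (i + 2)) ∧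
      PoleAtInfty (f (i + 4)) ∧ HoloAtInfty (f (i + 3)) ∧ HoloAtInfty (f (i + 5)))

/-- A tuple of rational functions has pole configuration of Type B at `t = ∞`. -/
def TypeB (f : Fin 6 → RatFunc ℂ) : Prop :=
  ∃ i : Fin 6,
    PoleAtInfty (f i) ∧ PoleAtInfty (f (i + 1)) ∧ PoleAtInfty (f (i + 2)) ∧
    PoleAtInfty (f (i + 3)) ∧ HoloAtInfty (f (i + 4)) ∧ HoloAtInfty (f (i + 5))


/-- The quadratic form multiplying `f i` in the `i`-th equation of the `A₅⁽¹⁾` system. -/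
def quadForm {R : Type*} [CommRing R] (h : Fin 6 → R) (i : Fin 6) : R :=
  h (i + 1) * h (i + 2) + h (i + 1) * h (i + 4) + h (i + 3) * h (i + 4)
    - h (i + 2) * h (i + 3) - h (i + 2) * h (i + 5) - h (i + 4) * h (i + 5)

/-- The differential at `a` of `h ↦ quadForm h i`, applied to `v`. -/
def quadFormDiff {R : Type*} [CommRing R] (a v : Fin 6 → R) (i : Fin 6) : R :=
  (v (i + 1) * a (i + 2) + a (i + 1) * v (i + 2))
    + (v (i + 1) * a (i + 4) + a (i + 1) * v (i + 4))
    + (v (i + 3) * a (i + 4) + a (i + 3) * v (i + 4))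
    - (v (i + 2) * a (i + 3) + a (i + 2) * v (i + 3))
    - (v (i + 2) * a (i + 5) + a (i + 2) * v (i + 5))
    - (v (i + 4) * a (i + 5) + a (i + 4) * v (i + 5))

theorem quadForm_rotate {R : Type*} [CommRing R] (h : Fin 6 → R) (k i : Fin 6) :
    quadForm (fun j => h (j + k)) i = quadForm h (i + k) := by
  simp only [quadForm, add_right_comm]

theorem forall_fin_six {p : Fin 6 → Prop} :
    (∀ i, p i) ↔ p 0 ∧ p 1 ∧ p 2 ∧ p 3 ∧ p 4 ∧ p 5 := by
  simp [Fin.forall_fin_succ]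

/-- A common zero of the cubic forms `a i * quadForm a i` normalised by the two constraints
is nondegenerate. -/
theorem quadForm_nondegenerate {a v : Fin 6 → ℂ}
    (ha : ∀ i, a i + a (i + 2) + a (i + 4) = 1) (hv : ∀ i, v i + v (i + 2) + v (i + 4) = 0)
    (h : ∀ i, a i * quadForm a i = 0)
    (hd : ∀ i, v i * quadForm a i + a i * quadFormDiff a v i = 0) : v = 0 := by
  have key : ∀ i, (a i = 0 ∧ v i * quadForm a i = 0) ∨
      (a i ≠ 0 ∧ quadForm a i = 0 ∧ quadFormDiff a v i = 0) := by
    intro i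
    have h1 := h i
    have h2 := hd i
    clear h hd ha hv
    by_cases h0 : a i = 0
    · exact Or.inl ⟨h0, by simpa [h0] using h2⟩
    · have h3 : quadForm a i = 0 := by simpa [h0] using h1
      exact Or.inr ⟨h0, h3, by simpa [h0, h3] using h2⟩
  have e0 := ha 0
  have e1 := ha 1
  have e2 := hv 0
  have e3 := hv 1
  rw [forall_fin_six] at key
  obtain ⟨k0, k1, k2, k3, k4, k5⟩ := key
  simp only [quadForm, quadFormDiff, Fin.reduceAdd, zero_add] at k0 k1 k2 k3 k4 k5 e0 e1 e2 e3
  have : ∀ i, v i = 0 := by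
    rw [forall_fin_six]
    generalize a 0 = x at *
    generalize a 1 = p at *
    generalize a 2 = y at *
    generalize a 3 = q at *
    generalize a 4 = z at *
    generalize a 5 = r at *
    rcases k0 with ⟨rfl, k0⟩ | k0 <;> rcases k2 with ⟨rfl, k2⟩ | k2 <;>
    rcases k4 with ⟨rfl, k4⟩ | k4 <;> rcases k1 with ⟨rfl, k1⟩ | k1 <;>
    rcases k3 with ⟨rfl, k3⟩ | k3 <;> rcases k5 with ⟨rfl, k5⟩ | k5 <;> grind
  exact funext this

/-- The possible supports of a nontrivial common zero of the cubic forms `a i * quadForm a i`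
whose even components add up to zero. -/
theorem exists_support_of_sum_eq_zero {a : Fin 6 → ℂ} (hs : a 0 + a 2 + a 4 = 0)
    (h : ∀ i, a i * quadForm a i = 0) (he : ¬(a 0 = 0 ∧ a 2 = 0 ∧ a 4 = 0))
    (ho : ¬(a 1 = 0 ∧ a 3 = 0 ∧ a 5 = 0)) :
    ∃ k, a k ≠ 0 ∧ a (2 + k) ≠ 0 ∧ a (3 + k) ≠ 0 ∧ a (5 + k) ≠ 0 := by
  suffices (a 0 ≠ 0 ∧ a 2 ≠ 0 ∧ a 3 ≠ 0 ∧ a 5 ≠ 0) ∨ (a 2 ≠ 0 ∧ a 4 ≠ 0 ∧ a 5 ≠ 0 ∧ a 1 ≠ 0) ∨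
      (a 4 ≠ 0 ∧ a 0 ≠ 0 ∧ a 1 ≠ 0 ∧ a 3 ≠ 0) by
    rcases this with h | h | h
    exacts [⟨0, h⟩, ⟨2, h⟩, ⟨4, h⟩]
  rw [forall_fin_six] at h
  obtain ⟨h0, h1, h2, h3, h4, h5⟩ := h
  simp only [quadForm, Fin.reduceAdd, zero_add] at h0 h1 h2 h3 h4 h5
  generalize a 0 = x at *
  generalize a 1 = p at *
  generalize a 2 = y at *
  generalize a 3 = q at *
  generalize a 4 = z at *
  generalize a 5 = r at *
  grind

theorem coeff_mul_mul_of_natDegree_le {R : Type*} [CommRing R] {p q r : R[X]} {l m n k : ℕ}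
    (hp : p.natDegree ≤ l) (hq : q.natDegree ≤ m) (hr : r.natDegree ≤ n) (hk : l + m + n = k) :
    (p * q * r).coeff k = p.coeff l * q.coeff m * r.coeff n := by
  subst hk
  rw [coeff_mul_add_eq_of_natDegree_le (natDegree_mul_le_of_le hp hq) hr,
    coeff_mul_add_eq_of_natDegree_le hp hq]

theorem coeff_mul_quadForm {P : Fin 6 → ℂ[X]} {e : Fin 6 → ℕ} (he : ∀ i, e (i + 2) = e i)
    (hP : ∀ i, (P i).natDegree ≤ e i) (i : Fin 6) :
    (P i * quadForm P i).coeff (2 * e i + e (i + 1)) =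
      (P i).coeff (e i) * quadForm (fun j => (P j).coeff (e j)) i := by
  have h2 := he i
  have h3 : e (i + 3) = e (i + 1) := by rw [← he (i + 1), add_assoc]; rfl
  have h4 : e (i + 4) = e i := by rw [← h2, ← he (i + 2), add_assoc]; rfl
  have h5 : e (i + 5) = e (i + 1) := by rw [← h3, ← he (i + 3), add_assoc]; rfl
  simp only [quadForm, mul_add, mul_sub, ← mul_assoc, coeff_add, coeff_sub]
  rw [coeff_mul_mul_of_natDegree_le (hP i) (hP (i + 1)) (hP (i + 2)) (by omega),
    coeff_mul_mul_of_natDegree_le (hP i) (hP (i + 1)) (hP (i + 4)) (by omega),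
    coeff_mul_mul_of_natDegree_le (hP i) (hP (i + 3)) (hP (i + 4)) (by omega),
    coeff_mul_mul_of_natDegree_le (hP i) (hP (i + 2)) (hP (i + 3)) (by omega),
    coeff_mul_mul_of_natDegree_le (hP i) (hP (i + 2)) (hP (i + 5)) (by omega),
    coeff_mul_mul_of_natDegree_le (hP i) (hP (i + 4)) (hP (i + 5)) (by omega)]

theorem coeff_mul_mul_sub_mul_mul {p q r p' q' r' : ℂ[X]} {n e : ℕ}
    (hp' : p'.natDegree ≤ n) (hq : q.natDegree ≤ n) (hq' : q'.natDegree ≤ n)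
    (hr : r.natDegree ≤ n) (hcp : p'.coeff n = p.coeff n)
    (hcq : q'.coeff n = q.coeff n) (hpp : (p - p').natDegree ≤ e)
    (hqq : (q - q').natDegree ≤ e) (hrr : (r - r').natDegree ≤ e) :
    (p * q * r - p' * q' * r').coeff (2 * n + e) =
      (p - p').coeff e * q.coeff n * r.coeff n + p.coeff n * (q - q').coeff e * r.coeff n
        + p.coeff n * q.coeff n * (r - r').coeff e := by
  have : p * q * r - p' * q' * r' = (p - p') * q * r + p' * (q - q') * r + p' * q' * (r - r') := by
    ring
  rw [this, coeff_add, coeff_add, coeff_mul_mul_of_natDegree_le hpp hq hr (by omega),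
    coeff_mul_mul_of_natDegree_le hp' hqq hr (by omega),
    coeff_mul_mul_of_natDegree_le hp' hq' hrr (by omega), hcp, hcq]

theorem coeff_mul_quadForm_sub {P P' : Fin 6 → ℂ[X]} {n e : ℕ} (hP : ∀ i, (P i).natDegree ≤ n)
    (hP' : ∀ i, (P' i).natDegree ≤ n) (hc : ∀ i, (P' i).coeff n = (P i).coeff n)
    (hd : ∀ i, (P i - P' i).natDegree ≤ e) (i : Fin 6) :
    (P i * quadForm P i - P' i * quadForm P' i).coeff (2 * n + e) =
      (P i - P' i).coeff e * quadForm (fun j => (P j).coeff n) i +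
        (P i).coeff n * quadFormDiff (fun j => (P j).coeff n) (fun j => (P j - P' j).coeff e) i := by
  have key := fun j k => coeff_mul_mul_sub_mul_mul (hP' i) (hP j) (hP' j) (hP k) (hc i) (hc j)
    (hd i) (hd j) (hd k)
  have : P i * quadForm P i - P' i * quadForm P' i =
      (P i * P (i + 1) * P (i + 2) - P' i * P' (i + 1) * P' (i + 2))
      + (P i * P (i + 1) * P (i + 4) - P' i * P' (i + 1) * P' (i + 4))
      + (P i * P (i + 3) * P (i + 4) - P' i * P' (i + 3) * P' (i + 4))
      - (P i * P (i + 2) * P (i + 3) - P' i * P' (i + 2) * P' (i + 3))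
      - (P i * P (i + 2) * P (i + 5) - P' i * P' (i + 2) * P' (i + 5))
      - (P i * P (i + 4) * P (i + 5) - P' i * P' (i + 4) * P' (i + 5)) := by
    simp only [quadForm]; ring
  rw [this]
  simp only [coeff_add _ _ (2 * n + e), coeff_sub _ _ (2 * n + e)]
  simp only [← coeff_sub _ _ (2 * n + e), key, quadForm, quadFormDiff]
  ring

/-- If the components `0, 2, 3, 5` attain the maximal degree of their parity class, and the
cubic terms are no larger than the equations allow, then all degrees are at most
`deg D + 1`. -/
theorem max_le_of_natDegree_eq {P : Fin 6 → ℂ[X]} {D : ℂ[X]} {m m' : ℕ} (hD : D.Monic)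
    (he : P 0 + P 2 + P 4 = X * D) (ho : P 1 + P 3 + P 5 = X * D)
    (hm : D.natDegree + 1 ≤ m) (hm' : D.natDegree + 1 ≤ m')
    (h0 : (P 0).natDegree = m) (h2 : (P 2).natDegree = m)
    (h3 : (P 3).natDegree = m') (h5 : (P 5).natDegree = m')
    (hdeg : ∀ i, (P i * quadForm P i).natDegree ≤
      2 * D.natDegree + max (P i).natDegree (D.natDegree + 1)) :
    max m m' ≤ D.natDegree + 1 := by
  set n := D.natDegree with hn
  by_contra! hM
  set M := max m m' with hMdef
  have hXD : (X * D).Monic := monic_X.mul hD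
  have hXDn : (X * D).natDegree = n + 1 := by
    rw [monic_X.natDegree_mul hD, natDegree_X]; ring
  have hQ : ∀ i, n + 1 ≤ (P i).natDegree → (quadForm P i).natDegree ≤ 2 * n := by
    intro i hi
    rcases eq_or_ne (quadForm P i) 0 with h | h
    · simp [h]
    · have hPi : P i ≠ 0 := by rintro h; simp [h] at hi
      have := hdeg i
      rw [natDegree_mul hPi h, max_eq_left hi] at this
      omega
  have hquot : ∀ T : ℂ[X], (X * D * T).natDegree ≤ 2 * n → T.natDegree ≤ n := by
    intro T hT
    rcases eq_or_ne T 0 with rfl | h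
    · simp
    · rw [natDegree_mul hXD.ne_zero h, hXDn] at hT
      omega
  have hQ0 := hQ 0 (by omega)
  have hQ2 := hQ 2 (by omega)
  have hQ3 := hQ 3 (by omega)
  have hQ5 := hQ 5 (by omega)
  have hU : (2 * P 1 - X * D + P 4).natDegree ≤ n := by
    apply hquot
    have : X * D * (2 * P 1 - X * D + P 4) = quadForm P 0 - quadForm P 2 := by
      simp only [quadForm, Fin.reduceAdd, zero_add]
      grind
    rw [this]
    exact natDegree_sub_le_of_le hQ0 hQ2 |>.trans (by simp)
  have hV : (2 * P 4 - X * D + P 1).natDegree ≤ n := by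
    apply hquot
    have : X * D * (2 * P 4 - X * D + P 1) = quadForm P 3 - quadForm P 5 := by
      simp only [quadForm, Fin.reduceAdd]
      grind
    rw [this]
    exact natDegree_sub_le_of_le hQ3 hQ5 |>.trans (by simp)
  set U := 2 * P 1 - X * D + P 4 with hUdef
  set V := 2 * P 4 - X * D + P 1 with hVdef
  have hcM : (X * D).coeff M = 0 := coeff_eq_zero_of_natDegree_lt (by omega)
  have hlead : ∀ A T : ℂ[X], X * D * T = A → A.natDegree ≤ n + M → T.natDegree ≤ M →
      T.coeff M = 0 := by
    intro A T hAT hA hT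
    have h : (X * D * T).coeff (n + 1 + M) = (X * D).coeff (n + 1) * T.coeff M :=
      coeff_mul_add_eq_of_natDegree_le hXDn.le hT
    rw [hAT, coeff_eq_zero_of_natDegree_lt (by omega), ← hXDn, hXD.coeff_natDegree, one_mul] at h
    exact h.symm
  have hXDM : (X * D).natDegree ≤ M := by omega
  have hP2 : (P 2).natDegree ≤ M := h2.le.trans (le_max_left _ _)
  have hP5 : (P 5).natDegree ≤ M := h5.le.trans (le_max_right _ _)
  have htwo : ∀ p : ℂ[X], p.natDegree ≤ M → (2 * p).natDegree ≤ M := by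
    intro p hp
    rw [two_mul]
    exact (natDegree_add_le_of_le hp hp).trans (by simp)
  have hR : (2 * P 5 - X * D).natDegree ≤ M :=
    (natDegree_sub_le_of_le (htwo _ hP5) hXDM).trans (by simp)
  have hY : (2 * P 2 - X * D).natDegree ≤ M :=
    (natDegree_sub_le_of_le (htwo _ hP2) hXDM).trans (by simp)
  have hcomb : ∀ A B : ℂ[X], A.natDegree ≤ n → B.natDegree ≤ n → (2 * A - B).natDegree ≤ n := by
    intro A B hA hB
    rw [two_mul]
    exact (natDegree_sub_le_of_le (natDegree_add_le_of_le hA hA) hB).trans (by simp)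
  have hbound : ∀ S A B p q : ℂ[X], S.natDegree ≤ 2 * n → A.natDegree ≤ n → B.natDegree ≤ n →
      p.natDegree ≤ M → q.natDegree ≤ M →
      (A * (2 * p) - B * q - 3 * S).natDegree ≤ n + M := by
    intro S A B p q hS hA hB hp hq
    have h3S : (3 * S).natDegree ≤ n + M :=
      (natDegree_mul_le_of_le (natDegree_ofNat 3).le hS).trans (by omega)
    exact (natDegree_sub_le_of_le (natDegree_sub_le_of_le
      (natDegree_mul_le_of_le hA (htwo p hp)) (natDegree_mul_le_of_le hB hq)) h3S).trans (by simp)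
  have hc1 : (P 2 + (2 * P 5 - X * D)).coeff M = 0 := by
    refine hlead _ _ ?_ (hbound _ _ _ _ _ hQ0 (hcomb U V hU hV) (hcomb V U hV hU) hP2 hR)
      ((natDegree_add_le_of_le hP2 hR).trans (by simp))
    simp only [hUdef, hVdef, quadForm, zero_add]
    grind
  have hc2 : (P 5 + (2 * P 2 - X * D)).coeff M = 0 := by
    refine hlead _ _ ?_ (hbound _ _ _ _ _ hQ3 (hcomb V U hV hU) (hcomb U V hU hV) hP5 hY)
      ((natDegree_add_le_of_le hP5 hY).trans (by simp))
    simp only [hUdef, hVdef, quadForm, Fin.reduceAdd]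
    grind
  have e1 : (P 2).coeff M = 0 ∧ (P 5).coeff M = 0 := by
    simp only [coeff_add, coeff_sub, hcM, two_mul] at hc1 hc2
    constructor
    · linear_combination (2 / 3) * hc2 - (1 / 3) * hc1
    · linear_combination (2 / 3) * hc1 - (1 / 3) * hc2
  have hne : ∀ p : ℂ[X], p.natDegree = M → p.coeff M ≠ 0 := by
    intro p hp h
    rw [← hp, coeff_natDegree, leadingCoeff_eq_zero] at h
    simp [h] at hp
    omega
  rcases max_choice m m' with h | h
  · exact hne (P 2) (by omega) e1.1
  · exact hne (P 5) (by omega) e1.2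

theorem natDegree_le_of_even {P : Fin 6 → ℂ[X]} {D : ℂ[X]} (hD : D.Monic)
    (hs : ∀ i, P i + P (i + 2) + P (i + 4) = X * D)
    (hdeg : ∀ i, (P i * quadForm P i).natDegree ≤
      2 * D.natDegree + max (P i).natDegree (D.natDegree + 1)) :
    (P 0).natDegree ≤ D.natDegree + 1 ∧ (P 2).natDegree ≤ D.natDegree + 1 ∧
      (P 4).natDegree ≤ D.natDegree + 1 := by
  set n := D.natDegree with hn
  by_contra hcon
  obtain ⟨m, hm⟩ : ∃ m, m = max (P 0).natDegree (max (P 2).natDegree (P 4).natDegree) := ⟨_, rfl⟩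
  obtain ⟨m', hm'⟩ : ∃ m, m = max (P 1).natDegree (max (P 3).natDegree (P 5).natDegree) :=
    ⟨_, rfl⟩
  have hXDn : (X * D).natDegree = n + 1 := by
    rw [monic_X.natDegree_mul hD, natDegree_X]; ring
  have hmn : n + 1 < m := by omega
  have hmn' : n + 1 ≤ m' := by
    rw [← hXDn, ← hs 1]
    exact (natDegree_add_le_of_le (natDegree_add_le_of_le le_rfl le_rfl) le_rfl).trans
      (by simp only [Fin.reduceAdd]; omega)
  obtain ⟨e, he⟩ : ∃ e : Fin 6 → ℕ, e = ![m, m', m, m', m, m'] := ⟨_, rfl⟩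
  have he2 : ∀ i, e (i + 2) = e i := by rw [forall_fin_six]; subst he; simp
  have hP : ∀ i, (P i).natDegree ≤ e i := by
    rw [forall_fin_six]; subst he; simp; omega
  have hemax : ∀ i, max (e i) (e (i + 1)) = max m m' := by
    rw [forall_fin_six]; subst he; simp [max_comm]
  have hen : ∀ i, n + 1 ≤ e i := by
    rw [forall_fin_six]; subst he; simp; omega
  have hzero : ∀ i, (P i).coeff (e i) * quadForm (fun j => (P j).coeff (e j)) i = 0 := by
    intro i
    rw [← coeff_mul_quadForm he2 hP i]
    apply coeff_eq_zero_of_natDegree_lt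
    have h1 := hdeg i
    have h2 := hP i
    have h3 := hen i
    have h4 := hen (i + 1)
    omega
  have htop : ∀ p q r : ℂ[X], ∀ d, d ≠ 0 →
      d = max p.natDegree (max q.natDegree r.natDegree) →
      ¬(p.coeff d = 0 ∧ q.coeff d = 0 ∧ r.coeff d = 0) := by
    rintro p q r d hd0 hd ⟨h1, h2, h3⟩
    have key : ∀ p : ℂ[X], p.coeff d = 0 → p.natDegree ≠ d := by
      intro p hp hpd
      rw [← hpd, coeff_natDegree, leadingCoeff_eq_zero] at hp
      simp [hp] at hpd
      omega
    have := key p h1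
    have := key q h2
    have := key r h3
    omega
  obtain ⟨k, hk0, hk2, hk3, hk5⟩ := exists_support_of_sum_eq_zero
    (a := fun j => (P j).coeff (e j))
    (by
      have h : (P 0 + P (0 + 2) + P (0 + 4)).coeff m = 0 := by
        rw [hs 0]
        exact coeff_eq_zero_of_natDegree_lt (by omega)
      simpa [he] using h)
    hzero
    (by simpa [he] using htop _ _ _ m (by omega) hm)
    (by simpa [he] using htop _ _ _ m' (by omega) hm')
  have hnd : ∀ j, (P j).coeff (e j) ≠ 0 → (P j).natDegree = e j := fun j hj =>
    natDegree_eq_of_le_of_coeff_ne_zero (hP j) hj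
  have h3 : e (3 + k) = e (k + 1) := by rw [← he2 (k + 1), add_assoc, add_comm]; rfl
  have h5 : e (5 + k) = e (k + 1) := by rw [← h3, ← he2 (3 + k), add_right_comm]; rfl
  have := max_le_of_natDegree_eq (P := fun j => P (j + k)) (m := e k) (m' := e (k + 1)) hD
    (by rw [← hs k, zero_add, add_comm 2, add_comm 4])
    (by rw [← hs (1 + k), add_right_comm 1 k 2, add_right_comm 1 k 4]; rfl)
    (hen k) (hen (k + 1))
    (by rw [zero_add]; exact hnd k hk0)
    (by rw [hnd _ hk2, add_comm, he2])
    (by rw [hnd _ hk3, h3]) (by rw [hnd _ hk5, h5])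
    (fun i => by rw [quadForm_rotate]; exact hdeg (i + k))
  have := hemax k
  omega

theorem natDegree_le_succ {P : Fin 6 → ℂ[X]} {D : ℂ[X]} (hD : D.Monic)
    (hs : ∀ i, P i + P (i + 2) + P (i + 4) = X * D)
    (hdeg : ∀ i, (P i * quadForm P i).natDegree ≤
      2 * D.natDegree + max (P i).natDegree (D.natDegree + 1)) (i : Fin 6) :
    (P i).natDegree ≤ D.natDegree + 1 := by
  obtain ⟨h0, h2, h4⟩ := natDegree_le_of_even hD hs hdeg
  obtain ⟨h1, h3, h5⟩ := natDegree_le_of_even (P := fun j => P (j + 1)) hD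
    (fun i => by rw [← hs (i + 1), add_right_comm i 1 2, add_right_comm i 1 4])
    (fun i => by rw [quadForm_rotate]; exact hdeg (i + 1))
  revert i
  rw [forall_fin_six]
  exact ⟨h0, h1, h2, h3, h4, h5⟩

/-- The functions `P i / D` form a solution of `A₅(α)`, with denominators cleared. -/
structure IsPolynomialSolution (α : Fin 6 → ℂ) (D : ℂ[X]) (P : Fin 6 → ℂ[X]) : Prop where
  sum_eq : ∀ i, P i + P (i + 2) + P (i + 4) = X * D
  ode : ∀ i, X * (derivative (P i) * D - P i * derivative D) * D =
    2 * (P i * quadForm P i) +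
      D ^ 2 * (C (1 - 2 * (α i + α (i + 2) + α (i + 4))) * P i + C (2 * α i) * (X * D))

theorem natDegree_X_mul_derivative_le (p : ℂ[X]) : (X * derivative p).natDegree ≤ p.natDegree := by
  rcases Nat.eq_zero_or_pos p.natDegree with h | h
  · simp [derivative_of_natDegree_zero h]
  · refine (natDegree_mul_le_of_le natDegree_X_le (natDegree_derivative_le p)).trans ?_
    omega

theorem natDegree_X_mul_wronskian_mul_le (p D : ℂ[X]) :
    (X * (derivative p * D - p * derivative D) * D).natDegree ≤
      2 * D.natDegree + p.natDegree := by
  have : X * (derivative p * D - p * derivative D) * D =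
      (X * derivative p * D - p * (X * derivative D)) * D := by ring
  rw [this]
  refine (natDegree_mul_le_of_le (natDegree_sub_le_of_le
    (natDegree_mul_le_of_le (natDegree_X_mul_derivative_le p) le_rfl)
    (natDegree_mul_le_of_le le_rfl (natDegree_X_mul_derivative_le D))) le_rfl).trans ?_
  simp only [max_self]
  omega

theorem natDegree_two_mul (p : ℂ[X]) : (2 * p).natDegree = p.natDegree := by
  rw [← C_ofNat, natDegree_C_mul two_ne_zero]

theorem IsPolynomialSolution.natDegree_mul_quadForm_le {α : Fin 6 → ℂ} {D : ℂ[X]}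
    {P : Fin 6 → ℂ[X]} (h : IsPolynomialSolution α D P) (i : Fin 6) :
    (P i * quadForm P i).natDegree ≤
      2 * D.natDegree + max (P i).natDegree (D.natDegree + 1) := by
  rw [← natDegree_two_mul, ← sub_eq_of_eq_add (h.ode i)]
  refine (natDegree_sub_le_of_le (natDegree_X_mul_wronskian_mul_le (P i) D)
    (natDegree_mul_le_of_le (natDegree_pow_le_of_le 2 le_rfl)
      (natDegree_add_le_of_le (natDegree_C_mul_le _ _)
        ((natDegree_C_mul_le _ _).trans (natDegree_mul_le_of_le natDegree_X_le le_rfl))))).trans ?_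
  omega

theorem IsPolynomialSolution.natDegree_sub_le {α : Fin 6 → ℂ} {D : ℂ[X]}
    {P P' : Fin 6 → ℂ[X]} (h : IsPolynomialSolution α D P) (h' : IsPolynomialSolution α D P')
    (i : Fin 6) :
    (P i * quadForm P i - P' i * quadForm P' i).natDegree ≤
      2 * D.natDegree + (P i - P' i).natDegree := by
  have key : 2 * (P i * quadForm P i - P' i * quadForm P' i) =
      X * (derivative (P i - P' i) * D - (P i - P' i) * derivative D) * D -
        D ^ 2 * (C (1 - 2 * (α i + α (i + 2) + α (i + 4))) * (P i - P' i)) := by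
    rw [derivative_sub]
    linear_combination h'.ode i - h.ode i
  rw [← natDegree_two_mul, key]
  refine (natDegree_sub_le_of_le (natDegree_X_mul_wronskian_mul_le _ D)
    (natDegree_mul_le_of_le (natDegree_pow_le_of_le 2 le_rfl) (natDegree_C_mul_le _ _))).trans ?_
  omega

/-- Two rational solutions of the same system with the same leading terms at infinity agree. -/
theorem IsPolynomialSolution.eq_of_coeff_eq {α : Fin 6 → ℂ} {D : ℂ[X]}
    {P P' : Fin 6 → ℂ[X]} (hD : D.Monic) (h : IsPolynomialSolution α D P)
    (h' : IsPolynomialSolution α D P')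
    (hc : ∀ i, (P' i).coeff (D.natDegree + 1) = (P i).coeff (D.natDegree + 1)) : P = P' := by
  set n := D.natDegree with hn
  have hP := natDegree_le_succ hD h.sum_eq h.natDegree_mul_quadForm_le
  have hP' := natDegree_le_succ hD h'.sum_eq h'.natDegree_mul_quadForm_le
  set e := Finset.univ.sup fun i => (P i - P' i).natDegree with he
  have hd : ∀ i, (P i - P' i).natDegree ≤ e := fun i =>
    Finset.le_sup (f := fun i => (P i - P' i).natDegree) (Finset.mem_univ i)
  have hv : (fun i => (P i - P' i).coeff e) = 0 := by
    apply quadForm_nondegenerate (a := fun i => (P i).coeff (n + 1))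
    · intro i
      simp only [← coeff_add, h.sum_eq i, coeff_X_mul]
      exact hD.coeff_natDegree
    · intro i
      have : P i - P' i + (P (i + 2) - P' (i + 2)) + (P (i + 4) - P' (i + 4)) = 0 := by
        linear_combination h.sum_eq i - h'.sum_eq i
      simp only [← coeff_add, this, coeff_zero]
    · intro i
      rw [← coeff_mul_quadForm (e := fun _ => n + 1) (fun _ => rfl) hP i]
      apply coeff_eq_zero_of_natDegree_lt
      have h1 := h.natDegree_mul_quadForm_le i
      have h2 := hP i
      omega
    · intro i
      rw [← coeff_mul_quadForm_sub hP hP' hc hd i]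
      apply coeff_eq_zero_of_natDegree_lt
      have h1 := h.natDegree_sub_le h' i
      have h2 := hd i
      omega
  have hv' : ∀ i, (P i - P' i).coeff e = 0 := fun i => congrFun hv i
  have he0 : e = 0 := by
    obtain ⟨i, -, hi⟩ := Finset.exists_mem_eq_sup Finset.univ Finset.univ_nonempty
      fun i => (P i - P' i).natDegree
    have h1 := hv' i
    rw [he, hi, coeff_natDegree, leadingCoeff_eq_zero] at h1
    rw [he, hi, h1, natDegree_zero]
  funext i
  have h1 := hd i
  have h2 := hv' i
  rw [he0] at h1 h2
  rw [← sub_eq_zero, eq_C_of_natDegree_le_zero h1, h2, C_0]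

theorem coeff_comp_neg_X (p : ℂ[X]) (k : ℕ) : (p.comp (-X)).coeff k = p.coeff k * (-1) ^ k := by
  rw [← comp_C_mul_X_coeff]
  simp

theorem IsPolynomialSolution.neg_comp_neg_X {α : Fin 6 → ℂ} {D : ℂ[X]} {P : Fin 6 → ℂ[X]}
    (hD : D.comp (-X) = D) (h : IsPolynomialSolution α D P) :
    IsPolynomialSolution α D fun i => -(P i).comp (-X) := by
  have hD' : (derivative D).comp (-X) = -derivative D := by
    have := congrArg derivative hD
    rw [derivative_comp, derivative_neg, derivative_X] at this
    linear_combination -this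
  constructor
  · intro i
    have := congrArg (fun p => p.comp (-X)) (h.sum_eq i)
    simp only [add_comp, mul_comp, X_comp, hD] at this
    linear_combination -this
  · intro i
    have := congrArg (fun p => p.comp (-X)) (h.ode i)
    simp only [quadForm, add_comp, sub_comp, mul_comp, X_comp, hD, hD', pow_comp, C_comp,
      ofNat_comp] at this
    simp only [quadForm, derivative_neg, derivative_comp, derivative_X]
    linear_combination -this

theorem IsPolynomialSolution.comp_neg_X {α : Fin 6 → ℂ} {D : ℂ[X]} {P : Fin 6 → ℂ[X]}
    (hm : D.Monic) (hD : D.comp (-X) = D) (h : IsPolynomialSolution α D P) (i : Fin 6) :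
    (P i).comp (-X) = -P i := by
  have hn : (-1 : ℂ) ^ D.natDegree = 1 := by
    have := coeff_comp_neg_X D D.natDegree
    rw [hD, hm.coeff_natDegree, one_mul] at this
    exact this.symm
  have := congrFun (h.eq_of_coeff_eq hm (h.neg_comp_neg_X hD) fun i => by
    rw [coeff_neg, coeff_comp_neg_X, pow_succ, hn]; ring) i
  exact neg_eq_iff_eq_neg.mp this.symm

/-- Every finite family of rational functions has a common denominator that is monic and even. -/
theorem exists_even_common_denom (f : Fin 6 → RatFunc ℂ) :
    ∃ D : ℂ[X], D.Monic ∧ D.comp (-X) = D ∧ ∀ j, (f j).denom ∣ D := by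
  set q := ∏ j, (f j).denom with hq
  have hqm : q.Monic := monic_prod_of_monic _ _ fun j _ => (f j).monic_denom
  refine ⟨q * ((-1) ^ q.natDegree * q.comp (-X)),
    hqm.mul hqm.neg_one_pow_natDegree_mul_comp_neg_X, ?_, fun j => ?_⟩
  · simp only [mul_comp, pow_comp, neg_comp, one_comp, comp_neg_X_comp_neg_X]
    ring
  · exact (Finset.dvd_prod_of_mem _ (Finset.mem_univ j)).mul_right _

theorem evalR_eq_div {f : RatFunc ℂ} {P D : ℂ[X]} (hP : f.num * D = P * f.denom) {t : ℂ}
    (hf : DefinedAt f t) (ht : D.eval t ≠ 0) : evalR f t = P.eval t / D.eval t := by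
  have h := congrArg (Polynomial.eval t) hP
  simp only [eval_mul] at h
  have hf' : f.denom.eval t ≠ 0 := hf
  simp only [evalR, RatFunc.eval, eval₂_id]
  rw [div_eq_div_iff hf' ht, h]

theorem IsA5Solution.exists_isPolynomialSolution {α : Fin 6 → ℂ} {f : Fin 6 → RatFunc ℂ}
    (hsol : IsA5Solution α f) {D : ℂ[X]} (hD : D.Monic) (hdvd : ∀ j, (f j).denom ∣ D) :
    ∃ P : Fin 6 → ℂ[X], (∀ j, (f j).num * D = P j * (f j).denom) ∧
      IsPolynomialSolution α D P := by
  choose c hc using hdvd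
  obtain ⟨he, ho, hode⟩ := hsol
  obtain ⟨P, hP⟩ : ∃ P : Fin 6 → ℂ[X], ∀ j, (f j).num * D = P j * (f j).denom :=
    ⟨fun j => (f j).num * c j, fun j => by linear_combination (f j).num * hc j⟩
  refine ⟨P, hP, ?_⟩
  have hfP : ∀ j, f j * algebraMap ℂ[X] (RatFunc ℂ) D = algebraMap ℂ[X] (RatFunc ℂ) (P j) := by
    intro j
    have hne : algebraMap ℂ[X] (RatFunc ℂ) (f j).denom ≠ 0 :=
      RatFunc.algebraMap_ne_zero (f j).denom_ne_zero
    have := congrArg (algebraMap ℂ[X] (RatFunc ℂ)) (hP j)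
    rw [map_mul, map_mul] at this
    nth_rw 1 [← RatFunc.num_div_denom (f j)]
    rw [div_mul_eq_mul_div, div_eq_iff hne, this]
  have hsum : ∀ i j k, f i + f j + f k = RatFunc.X → P i + P j + P k = X * D := by
    intro i j k h
    apply RatFunc.algebraMap_injective ℂ
    rw [map_add, map_add, map_mul, RatFunc.algebraMap_X, ← hfP, ← hfP, ← hfP, ← h]
    ring
  have hsum_eq : ∀ i, P i + P (i + 2) + P (i + 4) = X * D := by
    rw [forall_fin_six]
    have h0 := hsum _ _ _ he
    have h1 := hsum _ _ _ ho
    simp only [zero_add, Fin.reduceAdd]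
    exact ⟨h0, h1, by linear_combination h0, by linear_combination h1,
      by linear_combination h0, by linear_combination h1⟩
  refine ⟨hsum_eq, fun i => ?_⟩
  have hgood : {t : ℂ | D.eval t ≠ 0}.Infinite := by
    have : {t : ℂ | D.eval t ≠ 0} = {t : ℂ | D.IsRoot t}ᶜ := rfl
    rw [this]
    exact (Polynomial.finite_setOfPred_isRoot hD.ne_zero).infinite_compl
  refine eq_of_infinite_eval_eq _ _ (hgood.mono fun t ht => ?_)
  have hdef : ∀ s : ℂ, D.eval s ≠ 0 → ∀ j, DefinedAt (f j) s := by
    intro s hs j h0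
    rw [hc j, eval_mul, h0, zero_mul] at hs
    exact hs rfl
  have hev : ∀ s : ℂ, D.eval s ≠ 0 → ∀ j, evalR (f j) s = (P j).eval s / D.eval s :=
    fun s hs j => evalR_eq_div (hP j) (hdef s hs j) hs
  have hderiv : deriv (evalR (f i)) t =
      ((derivative (P i)).eval t * D.eval t - (P i).eval t * (derivative D).eval t) /
        D.eval t ^ 2 := by
    have hnear : evalR (f i) =ᶠ[𝓝 t] fun s => (P i).eval s / D.eval s :=
      (D.continuous.continuousAt.eventually_ne ht).mono fun s hs => hev s hs i
    rw [hnear.deriv_eq]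
    exact (((P i).hasDerivAt t).div (D.hasDerivAt t) ht).deriv
  have h := hode t (hdef t ht) i
  rw [hderiv] at h
  simp only [hev t ht] at h
  have hs := congrArg (Polynomial.eval t) (hsum_eq i)
  simp only [eval_add, eval_mul, eval_X] at hs
  have hDt : D.eval t ≠ 0 := ht
  simp only [Set.mem_ofPred_eq, quadForm, eval_add, eval_sub, eval_mul, eval_pow, eval_X, eval_C,
    eval_ofNat]
  field_simp at h
  linear_combination h + 2 * α i * D.eval t ^ 2 * hs

theorem definedAt_neg_of_comp_neg_X {f : RatFunc ℂ} {P D : ℂ[X]} (hD : D.Monic)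
    (hDX : D.comp (-X) = D) (hP : f.num * D = P * f.denom) (hPX : P.comp (-X) = -P) {t : ℂ}
    (ht : DefinedAt f t) : DefinedAt f (-t) ∧ evalR f (-t) = -evalR f t := by
  have hnd : f.num.comp (-X) * f.denom = -(f.num * f.denom.comp (-X)) := by
    have h := congrArg (fun p => p.comp (-X)) hP
    simp only [mul_comp, hDX, hPX] at h
    apply mul_right_cancel₀ hD.ne_zero
    linear_combination f.denom * h + f.denom.comp (-X) * hP
  have hdvd : f.denom ∣ f.denom.comp (-X) := by
    apply f.isCoprime_num_denom.symm.dvd_of_dvd_mul_left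
    rw [← dvd_neg, ← hnd]
    exact dvd_mul_left _ _
  have hneg : f.denom.eval (-t) ≠ 0 := by
    intro h0
    have := eval_eq_zero_of_dvd_of_eval_eq_zero hdvd h0
    simp only [eval_comp, eval_neg, eval_X, neg_neg] at this
    exact ht this
  refine ⟨hneg, ?_⟩
  have h := congrArg (Polynomial.eval t) hnd
  simp only [eval_mul, eval_neg, eval_comp, eval_X] at h
  have ht' : f.denom.eval t ≠ 0 := ht
  simp only [evalR, RatFunc.eval, eval₂_id]
  rw [← neg_div, div_eq_div_iff hneg ht', h, neg_mul]

/-- Each component of a rational solution of `A₅(α)` is an odd function. -/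
theorem stmt_0 (α : Fin 6 → ℂ) (f : Fin 6 → RatFunc ℂ)
    (hsum : α 0 + α 1 + α 2 + α 3 + α 4 + α 5 = 1)
    (hsol : IsA5Solution α f) :
    ∀ i : Fin 6, ∀ t : ℂ, DefinedAt (f i) t →
      DefinedAt (f i) (-t) ∧ evalR (f i) (-t) = -evalR (f i) t := by
  intro i t ht
  obtain ⟨D, hD, hDX, hdvd⟩ := exists_even_common_denom f
  obtain ⟨P, hP, hpoly⟩ := hsol.exists_isPolynomialSolution hD hdvd
  exact definedAt_neg_of_comp_neg_X hD hDX (hP i) (hpoly.comp_neg_X hD hDX i) ht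
end
end

section
/- Let (f_0,…,f_5) be a rational solution of A_5(α_0,…,α_5) such that for some i ∈ {0,…,5}, f_i and f_{i+1} have a pole at t=∞ and f_{i+2}, f_{i+3}, f_{i+4}, f_{i+5} are holomorphic at t=∞. Then, as |t| → ∞: t·(f_i(t) − t) → −(α_{i+2}+α_{i+4}), t·(f_{i+1}(t) − t) → α_{i+3}+α_{i+5}, t·f_{i+2}(t) → α_{i+2}, t·f_{i+3}(t) → −α_{i+3}, t·f_{i+4}(t) → α_{i+4}, and t·f_{i+5}(t) → −α_{i+5}. In particular f_i and f_{i+1} have a pole of order one at t=∞ with leading coefficient 1, and f_{i+2}, f_{i+3}, f_{i+4}, f_{i+5} tend to 0 at ∞. -/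
open Filter Topology Polynomial

noncomputable section

theorem evalR_eq_div_s1 (f : RatFunc ℂ) (t : ℂ) :
    evalR f t = f.num.eval t / f.denom.eval t := by
  simp [evalR, RatFunc.eval, Polynomial.eval₂_id]

theorem differentiableAt_evalR {f : RatFunc ℂ} {t : ℂ} (h : DefinedAt f t) :
    DifferentiableAt ℂ (evalR f) t := by
  have he : evalR f = fun t => f.num.eval t / f.denom.eval t := funext (evalR_eq_div_s1 f)
  rw [he]
  exact f.num.differentiableAt.div f.denom.differentiableAt h

theorem eventually_definedAt (f : RatFunc ℂ) :
    ∀ᶠ t in Bornology.cobounded ℂ, DefinedAt f t := by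
  have hfin : {t : ℂ | f.denom.IsRoot t}.Finite :=
    Polynomial.finite_setOfPred_isRoot f.denom_ne_zero
  exact Bornology.isBounded_def.mp hfin.isBounded

/-- Cauchy's estimate: a rational function bounded near `∞` has derivative tending to `0`. -/
theorem HoloAtInfty.tendsto_deriv {f : RatFunc ℂ} (h : HoloAtInfty f) :
    Tendsto (deriv (evalR f)) (Bornology.cobounded ℂ) (𝓝 0) := by
  obtain ⟨M, hM⟩ := h
  rw [eventually_map] at hM
  obtain ⟨R, -, hR⟩ :=
    (Filter.hasBasis_cobounded_norm (E := ℂ)).eventually_iff.mp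
      (hM.and (eventually_definedAt f))
  have hnorm : Tendsto (fun t : ℂ => ‖t‖) (Bornology.cobounded ℂ) atTop :=
    tendsto_norm_cobounded_atTop
  refine squeeze_zero_norm' (a := fun t : ℂ => M / (‖t‖ / 2)) ?_
    ((hnorm.atTop_div_const two_pos).const_div_atTop M)
  filter_upwards [hnorm.eventually_ge_atTop (2 * R), hnorm.eventually_gt_atTop 0] with t ht ht0
  have hfar : ∀ z ∈ Metric.closedBall t (‖t‖ / 2), R ≤ ‖z‖ := by
    intro z hz
    rw [mem_closedBall_iff_norm] at hz
    have := norm_sub_norm_le t z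
    rw [norm_sub_rev] at this
    linarith
  refine Complex.norm_deriv_le_of_forall_mem_sphere_norm_le (by positivity) ?_
    fun z hz => (hR (hfar z (Metric.sphere_subset_closedBall hz))).1
  refine DifferentiableOn.diffContOnCl_ball (U := Metric.closedBall t (‖t‖ / 2)) ?_ subset_rfl
  exact fun z hz => (differentiableAt_evalR (hR (hfar z hz)).2).differentiableWithinAt

theorem HoloAtInfty.tendsto_div {f : RatFunc ℂ} (h : HoloAtInfty f) :
    Tendsto (fun t => evalR f t / t) (Bornology.cobounded ℂ) (𝓝 0) := by
  simp only [div_eq_inv_mul]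
  exact tendsto_inv₀_cobounded.zero_mul_isBoundedUnder_le h

/-- The dominant balance in a scalar equation `(t/2) f' = f Q + k f + a S` with `Q ~ s t²`
and `S ~ t`. -/
theorem HoloAtInfty.tendsto_mul_of_ode {f : RatFunc ℂ} (h : HoloAtInfty f) {Q S : ℂ → ℂ}
    {k a s : ℂ} (hs : s ≠ 0)
    (hQ : Tendsto (fun t => Q t / t ^ 2) (Bornology.cobounded ℂ) (𝓝 s))
    (hS : Tendsto (fun t => S t / t) (Bornology.cobounded ℂ) (𝓝 1))
    (hode : ∀ᶠ t in Bornology.cobounded ℂ,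
      t / 2 * deriv (evalR f) t = evalR f t * Q t + k * evalR f t + a * S t) :
    Tendsto (fun t => t * evalR f t) (Bornology.cobounded ℂ) (𝓝 (-a / s)) := by
  have hlim := (((h.tendsto_deriv.div_const 2).sub (h.tendsto_div.const_mul k)).sub
    (hS.const_mul a)).div hQ hs
  simp only [zero_div, mul_zero, sub_zero, mul_one, zero_sub] at hlim
  refine hlim.congr' ?_
  filter_upwards [hode, hQ.eventually_ne hs, Bornology.eventually_ne_cobounded (0 : ℂ)]
    with t ht hQt ht0
  have hQ0 : Q t ≠ 0 := fun h0 => hQt (by simp [h0])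
  simp only [Pi.div_apply]
  field_simp
  linear_combination 2 * ht

/-- Rational functions summing to `t`, the last two bounded near `∞`: the first is `~ t`. -/
theorem tendsto_div_one_of_eventually_sum_eq {f g h : RatFunc ℂ}
    (hsum : ∀ᶠ t in Bornology.cobounded ℂ, evalR f t + evalR g t + evalR h t = t)
    (hg : HoloAtInfty g) (hh : HoloAtInfty h) :
    Tendsto (fun t => evalR f t / t) (Bornology.cobounded ℂ) (𝓝 1) := by
  have hlim := (tendsto_const_nhds (x := (1 : ℂ))).sub (hg.tendsto_div.add hh.tendsto_div)
  rw [add_zero, sub_zero] at hlim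
  refine hlim.congr' ?_
  filter_upwards [hsum, Bornology.eventually_ne_cobounded (0 : ℂ)] with t ht ht0
  field_simp
  linear_combination -ht

theorem eventually_evalR_add_add {f g h : RatFunc ℂ} (hsum : f + g + h = RatFunc.X) :
    ∀ᶠ t in Bornology.cobounded ℂ, evalR f t + evalR g t + evalR h t = t := by
  filter_upwards [eventually_definedAt f, eventually_definedAt g, eventually_definedAt h,
    eventually_definedAt (f + g)] with t hf hg hh hfg
  simp only [DefinedAt, ← Polynomial.eval₂_id] at hf hg hh hfg
  simp only [evalR]
  rw [← RatFunc.eval_add (RingHom.id ℂ) (a := t) hf hg,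
    ← RatFunc.eval_add (RingHom.id ℂ) (a := t) hfg hh, hsum, RatFunc.eval_X]

theorem IsA5Solution.add_add_eq_X {α : Fin 6 → ℂ} {f : Fin 6 → RatFunc ℂ}
    (hsol : IsA5Solution α f) (i : Fin 6) : f i + f (i + 2) + f (i + 4) = RatFunc.X := by
  obtain ⟨h0, h1, -⟩ := hsol
  fin_cases i <;> simp only [Fin.isValue, Fin.reduceFinMk, Fin.reduceAdd, Fin.zero_eta, zero_add]
  all_goals first | linear_combination h0 | linear_combination h1

theorem tendsto_zero_of_tendsto_mul {g : ℂ → ℂ} {L : ℂ}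
    (h : Tendsto (fun t => t * g t) (Bornology.cobounded ℂ) (𝓝 L)) :
    Tendsto g (Bornology.cobounded ℂ) (𝓝 0) := by
  have hlim := tendsto_inv₀_cobounded.mul h
  rw [zero_mul] at hlim
  refine hlim.congr' ?_
  filter_upwards [Bornology.eventually_ne_cobounded (0 : ℂ)] with t ht
  exact inv_mul_cancel_left₀ ht _

/-- Laurent behaviour at `t = ∞` for a Type A (1) rational solution. -/
theorem stmt_1 (α : Fin 6 → ℂ) (f : Fin 6 → RatFunc ℂ) (i : Fin 6)
    (hsum : α 0 + α 1 + α 2 + α 3 + α 4 + α 5 = 1)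
    (hsol : IsA5Solution α f)
    (hpi : PoleAtInfty (f i)) (hpi1 : PoleAtInfty (f (i + 1)))
    (hh2 : HoloAtInfty (f (i + 2))) (hh3 : HoloAtInfty (f (i + 3)))
    (hh4 : HoloAtInfty (f (i + 4))) (hh5 : HoloAtInfty (f (i + 5))) :
    Tendsto (fun t => t * (evalR (f i) t - t)) (Bornology.cobounded ℂ)
        (𝓝 (-(α (i + 2) + α (i + 4)))) ∧
    Tendsto (fun t => t * (evalR (f (i + 1)) t - t)) (Bornology.cobounded ℂ)
        (𝓝 (α (i + 3) + α (i + 5))) ∧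
    Tendsto (fun t => t * evalR (f (i + 2)) t) (Bornology.cobounded ℂ) (𝓝 (α (i + 2))) ∧
    Tendsto (fun t => t * evalR (f (i + 3)) t) (Bornology.cobounded ℂ) (𝓝 (-α (i + 3))) ∧
    Tendsto (fun t => t * evalR (f (i + 4)) t) (Bornology.cobounded ℂ) (𝓝 (α (i + 4))) ∧
    Tendsto (fun t => t * evalR (f (i + 5)) t) (Bornology.cobounded ℂ) (𝓝 (-α (i + 5))) ∧
    Tendsto (fun t => evalR (f (i + 2)) t) (Bornology.cobounded ℂ) (𝓝 0) ∧
    Tendsto (fun t => evalR (f (i + 3)) t) (Bornology.cobounded ℂ) (𝓝 0) ∧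
    Tendsto (fun t => evalR (f (i + 4)) t) (Bornology.cobounded ℂ) (𝓝 0) ∧
    Tendsto (fun t => evalR (f (i + 5)) t) (Bornology.cobounded ℂ) (𝓝 0) := by
  have hsum0 := eventually_evalR_add_add (hsol.add_add_eq_X i)
  have hsum1 := eventually_evalR_add_add (hsol.add_add_eq_X (i + 1))
  have hode : ∀ j, ∀ᶠ t in Bornology.cobounded ℂ, _ := fun j =>
    (eventually_all.mpr fun k => eventually_definedAt (f k)).mono
      fun t ht => hsol.2.2 t ht j
  have ode2 := hode (i + 2)
  have ode3 := hode (i + 3)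
  have ode4 := hode (i + 4)
  have ode5 := hode (i + 5)
  simp only [add_assoc i, Fin.reduceAdd, add_zero] at hsum1 ode2 ode3 ode4 ode5
  have l0 := tendsto_div_one_of_eventually_sum_eq hsum0 hh2 hh4
  have l1 := tendsto_div_one_of_eventually_sum_eq hsum1 hh3 hh5
  have l2 := hh2.tendsto_div
  have l3 := hh3.tendsto_div
  have l4 := hh4.tendsto_div
  have l5 := hh5.tendsto_div
  have r2 : Tendsto (fun t => t * evalR (f (i + 2)) t) (Bornology.cobounded ℂ)
      (𝓝 (α (i + 2))) := by
    have hQ := (((((l3.mul l4).add (l3.mul l0)).add (l5.mul l0)).sub (l4.mul l5)).sub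
      (l4.mul l1)).sub (l0.mul l1)
    have := hh2.tendsto_mul_of_ode (s := -1) (by norm_num)
      ((hQ.congr fun t => by ring).trans_eq (by norm_num))
      (((l4.add l0).congr fun t => by ring).trans_eq (by norm_num)) ode2
    simpa using this
  have r3 : Tendsto (fun t => t * evalR (f (i + 3)) t) (Bornology.cobounded ℂ)
      (𝓝 (-α (i + 3))) := by
    have hQ := (((((l4.mul l5).add (l4.mul l1)).add (l0.mul l1)).sub (l5.mul l0)).sub
      (l5.mul l2)).sub (l1.mul l2)
    have := hh3.tendsto_mul_of_ode (s := 1) (by norm_num)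
      ((hQ.congr fun t => by ring).trans_eq (by norm_num))
      (((l5.add l1).congr fun t => by ring).trans_eq (by norm_num)) ode3
    simpa using this
  have r4 : Tendsto (fun t => t * evalR (f (i + 4)) t) (Bornology.cobounded ℂ)
      (𝓝 (α (i + 4))) := by
    have hQ := (((((l5.mul l0).add (l5.mul l2)).add (l1.mul l2)).sub (l0.mul l1)).sub
      (l0.mul l3)).sub (l2.mul l3)
    have := hh4.tendsto_mul_of_ode (s := -1) (by norm_num)
      ((hQ.congr fun t => by ring).trans_eq (by norm_num))
      (((l0.add l2).congr fun t => by ring).trans_eq (by norm_num)) ode4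
    simpa using this
  have r5 : Tendsto (fun t => t * evalR (f (i + 5)) t) (Bornology.cobounded ℂ)
      (𝓝 (-α (i + 5))) := by
    have hQ := (((((l0.mul l1).add (l0.mul l3)).add (l2.mul l3)).sub (l1.mul l2)).sub
      (l1.mul l4)).sub (l3.mul l4)
    have := hh5.tendsto_mul_of_ode (s := 1) (by norm_num)
      ((hQ.congr fun t => by ring).trans_eq (by norm_num))
      (((l1.add l3).congr fun t => by ring).trans_eq (by norm_num)) ode5
    simpa using this
  refine ⟨?_, ?_, r2, r3, r4, r5, tendsto_zero_of_tendsto_mul r2, tendsto_zero_of_tendsto_mul r3,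
    tendsto_zero_of_tendsto_mul r4, tendsto_zero_of_tendsto_mul r5⟩
  · refine (r2.add r4).neg.congr' ?_
    filter_upwards [hsum0] with t ht
    linear_combination -t * ht
  · have := (r3.add r5).neg
    rw [neg_add, neg_neg, neg_neg] at this
    refine this.congr' ?_
    filter_upwards [hsum1] with t ht
    linear_combination -t * ht
end
end
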